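/- arXiv:1903.06585 — 5 statements merged into one kernel-verified Lean document; each statement's English description precedes it below -/
import Mathlib

section
/- Let 0 < r₁ ≤ r₂ < 2, let C > 0, let 0 < ε ≤ 1, and let r ∈ (0,2). Then the function x ↦ (x · C x^{r₁/r₂})^{r/2} · x^{-1-r₁} is (Lebesgue) integrable on the interval (0, ε) if and only if r > 2r₁r₂/(r₁ + r₂). Moreover 2r₁r₂/(r₁ + r₂) ≥ r₁ = min(r₁, r₂). -/
open MeasureTheory

/-- On the positive half-line the co-jump integrand is a constant multiple of a power of `x`. -/
lemma mul_rpow_rpow_mul_rpow_eq {C x : ℝ} (hC : 0 < C) (hx : 0 < x) (a p q : ℝ) :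
    (x * (C * x ^ a)) ^ p * x ^ q = C ^ p * x ^ ((1 + a) * p + q) := by
  have h : x * (C * x ^ a) = C * x ^ (1 + a) := by
    rw [Real.rpow_add hx, Real.rpow_one]
    ring
  rw [h, Real.mul_rpow hC.le (Real.rpow_nonneg hx.le _), ← Real.rpow_mul hx.le, mul_assoc,
    ← Real.rpow_add hx]

/-- The function `x ↦ (x · C x^(r₁/r₂))^(r/2) · x^(−1−r₁)` is Lebesgue integrable on
`(0, ε)` if and only if `r > 2r₁r₂/(r₁+r₂)`; moreover the harmonic mean
`2r₁r₂/(r₁+r₂)` is at least `r₁ = min(r₁,r₂)`. -/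
theorem stmt_2 (r₁ r₂ C ε r : ℝ) (h1 : 0 < r₁) (h12 : r₁ ≤ r₂) (h2 : r₂ < 2)
    (hC : 0 < C) (hε0 : 0 < ε) (hε1 : ε ≤ 1) (hr0 : 0 < r) (hr2 : r < 2) :
    (IntegrableOn (fun x : ℝ => (x * (C * x ^ (r₁ / r₂))) ^ (r / 2) * x ^ (-1 - r₁))
        (Set.Ioo 0 ε) ↔ r > 2 * r₁ * r₂ / (r₁ + r₂)) ∧
    2 * r₁ * r₂ / (r₁ + r₂) ≥ r₁ ∧ r₁ = min r₁ r₂ := by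
  have hr₂ : 0 < r₂ := h1.trans_le h12
  have hs : 0 < r₁ + r₂ := add_pos h1 hr₂
  refine ⟨?_, ?_, (min_eq_left h12).symm⟩
  · rw [integrableOn_congr_fun
      (fun x hx => mul_rpow_rpow_mul_rpow_eq hC hx.1 (r₁ / r₂) (r / 2) (-1 - r₁))
      measurableSet_Ioo, IntegrableOn,
      integrable_const_mul_iff (Real.rpow_pos_of_pos hC _).ne'.isUnit, ← IntegrableOn,
      intervalIntegral.integrableOn_Ioo_rpow_iff hε0, gt_iff_lt, div_lt_iff₀ hs]
    have h : (1 + r₁ / r₂) * (r / 2) + (-1 - r₁) - -1 =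
        (r * (r₁ + r₂) - 2 * r₁ * r₂) / (2 * r₂) := by
      field_simp
      ring
    rw [← sub_pos, h, div_pos_iff_of_pos_right (by positivity), sub_pos]
  · rw [ge_iff_le, le_div_iff₀ hs]
    nlinarith
end

section
/- Let F be a Borel measure on ℝ², let r ∈ (0,2) and M > 0, and assume ∫_{ℝ²} min(1, |x₁x₂|^{r/2}) dF ≤ M and F({x ∈ ℝ² : ‖x‖ > 1}) < ∞. Then for every U ≥ 1 the function x ↦ cos(U(x₁ − x₂)) − cos(U(x₁ + x₂)) is F-integrable and (1/(4U²)) · |∫_{ℝ²} (cos(U(x₁ − x₂)) − cos(U(x₁ + x₂))) dF(x)| ≤ (2^{r/2}/2) M U^{r−2} + (1/2) F({x : ‖x‖ > 1}) U^{−2}. -/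
open MeasureTheory

theorem abs_cos_sub_cos_le_rpow {r U : ℝ} (hr0 : 0 < r) (hr2 : r < 2) (hU : 0 ≤ U) (x y : ℝ) :
    |Real.cos (U * (x - y)) - Real.cos (U * (x + y))| ≤ 2 * U ^ r * |x * y| ^ (r / 2) := by
  have hprod : Real.cos (U * (x - y)) - Real.cos (U * (x + y))
      = 2 * (Real.sin (U * x) * Real.sin (U * y)) := by
    rw [mul_sub, mul_add, Real.cos_sub, Real.cos_add]
    ring
  have hone : |Real.sin (U * x) * Real.sin (U * y)| ≤ 1 := by
    rw [abs_mul]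
    exact mul_le_one₀ (Real.abs_sin_le_one _) (abs_nonneg _) (Real.abs_sin_le_one _)
  have hlin : |Real.sin (U * x) * Real.sin (U * y)| ≤ U ^ (2 : ℝ) * |x * y| := by
    calc |Real.sin (U * x) * Real.sin (U * y)|
        = |Real.sin (U * x)| * |Real.sin (U * y)| := abs_mul _ _
      _ ≤ |U * x| * |U * y| :=
        mul_le_mul Real.abs_sin_le_abs Real.abs_sin_le_abs (abs_nonneg _) (abs_nonneg _)
      _ = U ^ (2 : ℝ) * |x * y| := by
        rw [abs_mul, abs_mul, abs_mul, abs_of_nonneg hU, Real.rpow_two]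
        ring
  have hroot : |Real.sin (U * x) * Real.sin (U * y)|
      ≤ |Real.sin (U * x) * Real.sin (U * y)| ^ (r / 2) :=
    Real.self_le_rpow_of_le_one (abs_nonneg _) hone (by linarith)
  have hmono := Real.rpow_le_rpow (abs_nonneg _) hlin (by linarith : 0 ≤ r / 2)
  rw [Real.mul_rpow (by positivity) (abs_nonneg _), ← Real.rpow_mul hU,
    mul_div_cancel₀ r two_ne_zero] at hmono
  rw [hprod, abs_mul, abs_two]
  linarith

theorem abs_cos_sub_cos_le_two (a b : ℝ) : |Real.cos a - Real.cos b| ≤ 2 := by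
  rw [abs_le]
  constructor <;>
    linarith [Real.cos_le_one a, Real.neg_one_le_cos a, Real.cos_le_one b, Real.neg_one_le_cos b]

theorem abs_mul_le_one_of_sqrt_le_one {x y : ℝ} (h : Real.sqrt (x ^ 2 + y ^ 2) ≤ 1) :
    |x * y| ≤ 1 := by
  rw [Real.sqrt_le_iff] at h
  rw [abs_le]
  constructor <;> nlinarith [h.2, sq_nonneg (x - y), sq_nonneg (x + y)]

/-- Deterministic-error bound for the spectral estimator: if
`∫ min(1,|x₁x₂|^(r/2)) dF ≤ M` and `F({‖x‖ > 1}) < ∞`, then for every `U ≥ 1`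
the function `x ↦ cos(U(x₁−x₂)) − cos(U(x₁+x₂))` is `F`-integrable and
`(1/(4U²))|∫ (cos(U(x₁−x₂)) − cos(U(x₁+x₂))) dF| ≤ (2^(r/2)/2) M U^(r−2)
  + (1/2) F({‖x‖>1}) U^(−2)`. -/
theorem stmt_4 (F : Measure (ℝ × ℝ)) (r M : ℝ) (hr0 : 0 < r) (hr2 : r < 2) (hM : 0 < M)
    (h1 : (∫⁻ x : ℝ × ℝ, ENNReal.ofReal (min 1 (|x.1 * x.2| ^ (r / 2))) ∂F)
        ≤ ENNReal.ofReal M)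
    (h2 : F {x : ℝ × ℝ | 1 < Real.sqrt (x.1 ^ 2 + x.2 ^ 2)} < ⊤) :
    ∀ U : ℝ, 1 ≤ U →
      Integrable (fun x : ℝ × ℝ =>
        Real.cos (U * (x.1 - x.2)) - Real.cos (U * (x.1 + x.2))) F ∧
      1 / (4 * U ^ 2) *
          |∫ x : ℝ × ℝ, (Real.cos (U * (x.1 - x.2)) - Real.cos (U * (x.1 + x.2))) ∂F|
        ≤ (2 : ℝ) ^ (r / 2) / 2 * M * U ^ (r - 2) +
          1 / 2 * (F {x : ℝ × ℝ | 1 < Real.sqrt (x.1 ^ 2 + x.2 ^ 2)}).toReal *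
            U ^ (-2 : ℝ) := by
  intro U hU
  have hU0 : 0 < U := by linarith
  set A : Set (ℝ × ℝ) := {x | 1 < Real.sqrt (x.1 ^ 2 + x.2 ^ 2)} with hA
  set g : ℝ × ℝ → ℝ := fun x => min 1 (|x.1 * x.2| ^ (r / 2)) with hg
  have hg0 : ∀ x, 0 ≤ g x := fun x => le_min zero_le_one (by positivity)
  have hgm : Measurable g := by fun_prop
  have hAm : MeasurableSet A := measurableSet_lt (by fun_prop) (by fun_prop)
  have hgi : Integrable g F := by
    refine ⟨hgm.aestronglyMeasurable, ?_⟩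
    rw [hasFiniteIntegral_iff_ofReal (Filter.Eventually.of_forall hg0)]
    exact h1.trans_lt ENNReal.ofReal_lt_top
  have hgM : ∫ x, g x ∂F ≤ M := by
    rw [integral_eq_lintegral_of_nonneg_ae (Filter.Eventually.of_forall hg0)
      hgm.aestronglyMeasurable]
    exact ENNReal.toReal_le_of_le_ofReal hM.le h1
  have hAi : Integrable (A.indicator fun _ => (2 : ℝ)) F :=
    (integrable_indicator_iff hAm).2 (integrableOn_const h2.ne)
  have hgi' : Integrable (fun x => 2 * U ^ r * g x) F := hgi.const_mul _
  have hbound : ∀ x : ℝ × ℝ,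
      ‖Real.cos (U * (x.1 - x.2)) - Real.cos (U * (x.1 + x.2))‖
        ≤ 2 * U ^ r * g x + A.indicator (fun _ => (2 : ℝ)) x := by
    intro x
    rw [Real.norm_eq_abs]
    by_cases hx : x ∈ A
    · rw [Set.indicator_of_mem hx]
      have := mul_nonneg (by positivity : 0 ≤ 2 * U ^ r) (hg0 x)
      linarith [abs_cos_sub_cos_le_two (U * (x.1 - x.2)) (U * (x.1 + x.2))]
    · rw [Set.indicator_of_notMem hx, add_zero]
      have hle : |x.1 * x.2| ≤ 1 := abs_mul_le_one_of_sqrt_le_one (not_lt.1 hx)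
      have hgx : g x = |x.1 * x.2| ^ (r / 2) :=
        min_eq_right (Real.rpow_le_one (abs_nonneg _) hle (by linarith))
      rw [hgx]
      exact abs_cos_sub_cos_le_rpow hr0 hr2 hU0.le _ _
  refine ⟨(hgi'.add hAi).mono' (by fun_prop) (Filter.Eventually.of_forall hbound), ?_⟩
  have hint := norm_integral_le_of_norm_le (hgi'.add hAi) (Filter.Eventually.of_forall hbound)
  simp only [Pi.add_apply] at hint
  rw [integral_add hgi' hAi, integral_const_mul, integral_indicator_const _ hAm,
    Real.norm_eq_abs, smul_eq_mul, measureReal_def] at hint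
  have hUr : U ^ (r - 2) = U ^ r / U ^ 2 := by rw [Real.rpow_sub hU0, Real.rpow_two]
  have hU2 : U ^ (-2 : ℝ) = 1 / U ^ 2 := by rw [Real.rpow_neg hU0.le, Real.rpow_two, one_div]
  have hpow : (1 : ℝ) ≤ 2 ^ (r / 2) := Real.one_le_rpow one_le_two (by linarith)
  have hgM' : 2 * U ^ r * ∫ x, g x ∂F ≤ 2 * U ^ r * (2 ^ (r / 2) * M) := by
    gcongr
    exact hgM.trans (le_mul_of_one_le_left hM.le hpow)
  calc _ ≤ 1 / (4 * U ^ 2) * (2 * U ^ r * (2 ^ (r / 2) * M) + (F A).toReal * 2) := by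
        gcongr
        exact hint.trans (by gcongr)
    _ = _ := by
        rw [hUr, hU2]
        field_simp
        ring
end

section
/- For n ≥ 3, let P_n be the centered Gaussian measure on ℝ² with covariance matrix Σ₁ = [[2, 1], [1, 1]] and let Q_n be the centered Gaussian measure on ℝ² with covariance matrix Σ₂(n) = [[2, 1 + 1/n], [1 + 1/n, 1]] (both matrices are positive definite for n ≥ 3). Then the Kullback–Leibler divergence KL(Q_n, P_n) tends to 0 as n → ∞. -/
open MeasureTheory

/-- The Lebesgue density of the centered bivariate Gaussian measure with (positive
definite) covariance matrix `S`: `x ↦ (2π)⁻¹ (det S)^(−1/2) exp(−⟨S⁻¹x,x⟩/2)`. -/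
noncomputable def gaussDensity2 (S : Matrix (Fin 2) (Fin 2) ℝ) (x : ℝ × ℝ) : ℝ :=
  (2 * Real.pi)⁻¹ * S.det ^ (-(1 : ℝ) / 2) *
    Real.exp (-((S⁻¹ 0 0 * x.1 + S⁻¹ 0 1 * x.2) * x.1 +
        (S⁻¹ 1 0 * x.1 + S⁻¹ 1 1 * x.2) * x.2) / 2)

/-- The Kullback–Leibler divergence `KL(Q,P) = ∫ log(dQ/dP) dQ` between measures on `ℝ²`
with Lebesgue densities `q` and `p`, expressed as `∫ q(x) log(q(x)/p(x)) dx`. -/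
noncomputable def klDiv2 (q p : ℝ × ℝ → ℝ) : ℝ :=
  ∫ x : ℝ × ℝ, q x * Real.log (q x / p x)

/-- The quadratic form `⟨S⁻¹ z, z⟩` for the covariance matrix `S = [[2, 1 + t], [1 + t, 1]]`. -/
noncomputable def covForm (t : ℝ) (z : ℝ × ℝ) : ℝ :=
  (z.1 ^ 2 - 2 * (1 + t) * (z.1 * z.2) + 2 * z.2 ^ 2) / (2 - (1 + t) ^ 2)

theorem gaussDensity2_eq (t : ℝ) (z : ℝ × ℝ) :
    gaussDensity2 !![2, 1 + t; 1 + t, 1] z =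
      (2 * Real.pi)⁻¹ * (2 - (1 + t) ^ 2) ^ (-(1 : ℝ) / 2) * Real.exp (-covForm t z / 2) := by
  have hdet : (!![2, 1 + t; 1 + t, 1] : Matrix (Fin 2) (Fin 2) ℝ).det = 2 - (1 + t) ^ 2 := by
    rw [Matrix.det_fin_two_of]; ring
  simp only [gaussDensity2, Matrix.inv_def, hdet, Matrix.adjugate_fin_two_of,
    Ring.inverse_eq_inv', covForm]
  congr 2
  simp
  ring

theorem gaussDensity2_one_eq (z : ℝ × ℝ) :
    gaussDensity2 !![2, 1; 1, 1] z = (2 * Real.pi)⁻¹ * Real.exp (-covForm 0 z / 2) := by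
  have h := gaussDensity2_eq 0 z
  norm_num at h
  simpa using h

theorem log_gaussDensity2_div {t : ℝ} (ht : 0 < 2 - (1 + t) ^ 2) (z : ℝ × ℝ) :
    Real.log (gaussDensity2 !![2, 1 + t; 1 + t, 1] z / gaussDensity2 !![2, 1; 1, 1] z) =
      -(1 : ℝ) / 2 * Real.log (2 - (1 + t) ^ 2) + (covForm 0 z - covForm t z) / 2 := by
  rw [gaussDensity2_eq, gaussDensity2_one_eq]
  have hpi := Real.pi_pos
  have hd := Real.rpow_pos_of_pos ht (-(1 : ℝ) / 2)
  rw [Real.log_div (by positivity) (by positivity), Real.log_mul (by positivity) (by positivity),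
    Real.log_mul (by positivity) (by positivity), Real.log_mul (by positivity) (by positivity),
    Real.log_exp, Real.log_exp, Real.log_rpow ht]
  ring

theorem covForm_bounds {t : ℝ} (h0 : 0 ≤ t) (h1 : t ≤ 1 / 10) (z : ℝ × ℝ) :
    (z.1 ^ 2 + z.2 ^ 2) / 5 ≤ covForm t z ∧ covForm t z ≤ 4 * (z.1 ^ 2 + z.2 ^ 2) := by
  obtain ⟨x, y⟩ := z
  have hd : 79 / 100 ≤ 2 - (1 + t) ^ 2 := by nlinarith
  have hd1 : 2 - (1 + t) ^ 2 ≤ 1 := by nlinarith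
  have hdpos : 0 < 2 - (1 + t) ^ 2 := by linarith
  have hr : 0 ≤ x ^ 2 + y ^ 2 := by positivity
  simp only [covForm]
  rw [le_div_iff₀ hdpos, div_le_iff₀ hdpos]
  constructor
  · have h : (x ^ 2 + y ^ 2) / 5 ≤ x ^ 2 - 2 * (1 + t) * (x * y) + 2 * y ^ 2 := by
      nlinarith [sq_nonneg (4 * x - 5 * (1 + t) * y), sq_nonneg y,
        mul_nonneg (sq_nonneg y) (by nlinarith : (0 : ℝ) ≤ 121 / 100 - (1 + t) ^ 2)]
    nlinarith
  · have h : x ^ 2 - 2 * (1 + t) * (x * y) + 2 * y ^ 2 ≤ 316 / 100 * (x ^ 2 + y ^ 2) := by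
      nlinarith [mul_nonneg (by linarith : (0 : ℝ) ≤ 1 + t) (sq_nonneg (x + y)),
        mul_nonneg (by linarith : (0 : ℝ) ≤ 1 / 10 - t) hr, sq_nonneg x, sq_nonneg y]
    nlinarith

theorem abs_gaussDensity2_mul_log_le {t : ℝ} (h0 : 0 ≤ t) (h1 : t ≤ 1 / 10) (z : ℝ × ℝ) :
    |gaussDensity2 !![2, 1 + t; 1 + t, 1] z *
      Real.log (gaussDensity2 !![2, 1 + t; 1 + t, 1] z / gaussDensity2 !![2, 1; 1, 1] z)| ≤
      40 * (Real.exp (-(1 / 20) * z.1 ^ 2) * Real.exp (-(1 / 20) * z.2 ^ 2)) := by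
  have hd : 79 / 100 ≤ 2 - (1 + t) ^ 2 := by nlinarith
  have hd1 : 2 - (1 + t) ^ 2 ≤ 1 := by nlinarith
  have hdpos : 0 < 2 - (1 + t) ^ 2 := by linarith
  obtain ⟨hlow, hup⟩ := covForm_bounds h0 h1 z
  obtain ⟨hlow', hup'⟩ := covForm_bounds le_rfl (by norm_num) z
  rw [log_gaussDensity2_div hdpos, gaussDensity2_eq, ← Real.exp_add, abs_mul]
  set d := 2 - (1 + t) ^ 2
  set r := z.1 ^ 2 + z.2 ^ 2 with hr_def
  have hr : 0 ≤ r := by positivity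
  have hpow : d ^ (-(1 : ℝ) / 2) ≤ 2 := by
    calc d ^ (-(1 : ℝ) / 2) ≤ d ^ (-1 : ℝ) :=
          Real.rpow_le_rpow_of_exponent_ge hdpos hd1 (by norm_num)
      _ = d⁻¹ := Real.rpow_neg_one d
      _ ≤ 2 := by rw [inv_le_comm₀ hdpos two_pos]; linarith
  have hpi : (2 * Real.pi)⁻¹ ≤ 1 / 2 := by
    rw [inv_le_comm₀ (by positivity) (by norm_num)]
    linarith [Real.pi_gt_three]
  have hpref : (2 * Real.pi)⁻¹ * d ^ (-(1 : ℝ) / 2) ≤ 1 := by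
    calc (2 * Real.pi)⁻¹ * d ^ (-(1 : ℝ) / 2) ≤ 1 / 2 * 2 := by gcongr
      _ = 1 := by norm_num
  have hexp : Real.exp (-covForm t z / 2) ≤ Real.exp (-r / 10) :=
    Real.exp_le_exp.mpr (by linarith)
  have hq : |(2 * Real.pi)⁻¹ * d ^ (-(1 : ℝ) / 2) * Real.exp (-covForm t z / 2)| ≤
      Real.exp (-r / 10) := by
    rw [abs_of_nonneg (by positivity)]
    calc _ ≤ 1 * Real.exp (-r / 10) := by gcongr
      _ = _ := one_mul _
  have hlog0 : Real.log d ≤ 0 := Real.log_nonpos hdpos.le hd1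
  have hlog1 : -1 ≤ Real.log d := by
    have h := Real.one_sub_inv_le_log_of_pos hdpos
    have h2 : d⁻¹ ≤ 2 := by rw [inv_le_comm₀ hdpos two_pos]; linarith
    linarith
  have hl : |-(1 : ℝ) / 2 * Real.log d + (covForm 0 z - covForm t z) / 2| ≤
      40 * Real.exp (r / 20) := by
    have h := Real.add_one_le_exp (r / 20)
    rw [abs_le]
    constructor <;> linarith
  calc _ ≤ Real.exp (-r / 10) * (40 * Real.exp (r / 20)) := by gcongr
    _ = 40 * (Real.exp (-r / 10) * Real.exp (r / 20)) := by ring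
    _ = _ := by
      rw [← Real.exp_add]
      congr 2
      rw [hr_def]
      ring

theorem continuousAt_gaussDensity2 (z : ℝ × ℝ) :
    ContinuousAt (fun t : ℝ => gaussDensity2 !![2, 1 + t; 1 + t, 1] z) 0 := by
  simp only [gaussDensity2_eq, covForm]
  have h : (2 - (1 + (0 : ℝ)) ^ 2) ≠ 0 := by norm_num
  have hc : ContinuousAt (fun t : ℝ => 2 - (1 + t) ^ 2) 0 := by fun_prop
  refine (continuousAt_const.mul (hc.rpow_const (Or.inl h))).mul ?_
  refine Real.continuous_exp.continuousAt.comp ?_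
  exact ((ContinuousAt.div (by fun_prop) hc h).neg).div_const 2

theorem tendsto_gaussDensity2_mul_log (z : ℝ × ℝ) :
    Filter.Tendsto (fun t : ℝ => gaussDensity2 !![2, 1 + t; 1 + t, 1] z *
      Real.log (gaussDensity2 !![2, 1 + t; 1 + t, 1] z / gaussDensity2 !![2, 1; 1, 1] z))
      (nhds 0) (nhds 0) := by
  have hp : gaussDensity2 !![2, 1; 1, 1] z ≠ 0 := by
    rw [gaussDensity2_one_eq]
    have := Real.pi_pos
    positivity
  have hq : Filter.Tendsto (fun t : ℝ => gaussDensity2 !![2, 1 + t; 1 + t, 1] z) (nhds 0)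
      (nhds (gaussDensity2 !![2, 1; 1, 1] z)) := by
    simpa [ContinuousAt] using continuousAt_gaussDensity2 z
  have hdiv := hq.div_const (gaussDensity2 !![2, 1; 1, 1] z)
  rw [div_self hp] at hdiv
  simpa using hq.mul (hdiv.log one_ne_zero)

theorem measurable_gaussDensity2 (S : Matrix (Fin 2) (Fin 2) ℝ) :
    Measurable (gaussDensity2 S) := by
  unfold gaussDensity2
  fun_prop

/-- With `P_n = N(0, [[2,1],[1,1]])` and `Q_n = N(0, [[2,1+1/n],[1+1/n,1]])` (positive
definite for `n ≥ 3`), the Kullback–Leibler divergence `KL(Q_n, P_n)` tends to `0`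
as `n → ∞`. -/
theorem stmt_9 :
    Filter.Tendsto
      (fun n : ℕ =>
        klDiv2
          (gaussDensity2 !![2, 1 + 1 / (n : ℝ); 1 + 1 / (n : ℝ), 1])
          (gaussDensity2 !![2, 1; 1, 1]))
      Filter.atTop (nhds 0) := by
  have hlim : Filter.Tendsto (fun n : ℕ => 1 / (n : ℝ)) Filter.atTop (nhds 0) :=
    tendsto_one_div_atTop_nhds_zero_nat
  unfold klDiv2
  rw [← integral_zero (ℝ × ℝ) ℝ]
  refine tendsto_integral_filter_of_dominated_convergence
    (fun z : ℝ × ℝ => 40 * (Real.exp (-(1 / 20) * z.1 ^ 2) * Real.exp (-(1 / 20) * z.2 ^ 2)))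
    (Filter.Eventually.of_forall fun n => ?_) ?_ ?_
    (Filter.Eventually.of_forall fun z => (tendsto_gaussDensity2_mul_log z).comp hlim)
  · exact ((measurable_gaussDensity2 _).mul
      ((measurable_gaussDensity2 _).div
        (measurable_gaussDensity2 _)).log).aestronglyMeasurable
  · filter_upwards [hlim.eventually_le_const (by norm_num : (0 : ℝ) < 1 / 10)] with n hn
    exact Filter.Eventually.of_forall fun z =>
      abs_gaussDensity2_mul_log_le (by positivity) hn z
  · have h := integrable_exp_neg_mul_sq (by norm_num : (0 : ℝ) < 1 / 20)
    exact (h.mul_prod h).const_mul 40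
end

section
/- Let w > 0 and U₀ ≥ 1, and define h : ℝ → ℝ by h(U) = w for |U| ≤ U₀ and h(U) = w · exp(−(|U| − U₀)³) for |U| > U₀. Then for every x ≠ 0, the integral H(x) := ∫_ℝ h(U) cos(Ux) dU converges absolutely and |H(x)| ≤ 2w · (|sin(U₀ x)|/|x| + ∫_0^∞ e^{−K³} dK) ≤ 2w · (|sin(U₀ x)|/|x| + 1). -/
open MeasureTheory

theorem integrableOn_Ioi_exp_neg_cube :
    IntegrableOn (fun K : ℝ => Real.exp (-K ^ 3)) (Set.Ioi 0) := by
  have h := integrableOn_rpow_mul_exp_neg_rpow (p := 3) (s := 0) (by norm_num) (by norm_num)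
  refine h.congr_fun (fun K _ => ?_) measurableSet_Ioi
  simp only [Real.rpow_zero, one_mul]
  norm_cast

theorem integral_Ioi_exp_neg_cube_le_one :
    ∫ K in Set.Ioi (0 : ℝ), Real.exp (-K ^ 3) ≤ 1 := by
  have h := integral_exp_neg_rpow (p := 3) (by norm_num)
  norm_cast at h
  rw [h]
  have hc := Real.convexOn_Gamma.2 (Set.mem_Ioi.mpr one_pos) (Set.mem_Ioi.mpr two_pos)
    (show (0 : ℝ) ≤ 2 / 3 by norm_num) (show (0 : ℝ) ≤ 1 / 3 by norm_num) (by norm_num)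
  norm_num [Real.Gamma_one, Real.Gamma_two] at hc ⊢
  exact hc

theorem integrableOn_Ioi_exp_neg_sub_cube (a : ℝ) :
    IntegrableOn (fun K : ℝ => Real.exp (-(K - a) ^ 3)) (Set.Ioi a) := by
  have h := ((measurePreserving_sub_right volume a).integrableOn_comp_preimage
    (MeasurableEquiv.subRight a).measurableEmbedding).mpr integrableOn_Ioi_exp_neg_cube
  simpa [Function.comp_def] using h

theorem integral_Ioi_exp_neg_sub_cube (a : ℝ) :
    ∫ K in Set.Ioi a, Real.exp (-(K - a) ^ 3) = ∫ K in Set.Ioi (0 : ℝ), Real.exp (-K ^ 3) := by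
  have h := (measurePreserving_sub_right volume a).setIntegral_preimage_emb
    (MeasurableEquiv.subRight a).measurableEmbedding (fun K : ℝ => Real.exp (-K ^ 3)) (Set.Ioi 0)
  simpa using h

theorem integrable_comp_abs_of_integrableOn_Ioi {f : ℝ → ℝ} (hf : IntegrableOn f (Set.Ioi 0)) :
    Integrable (fun U => f |U|) := by
  have hpos : IntegrableOn (fun U => f |U|) (Set.Ioi 0) :=
    hf.congr_fun (fun U hU => by simp only [abs_of_pos (Set.mem_Ioi.mp hU)]) measurableSet_Ioi
  have hneg : IntegrableOn (fun U => f |U|) (Set.Iic 0) := by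
    rw [integrableOn_Iic_iff_integrableOn_Iio]
    have h := ((Measure.measurePreserving_neg (volume : Measure ℝ)).integrableOn_comp_preimage
      (MeasurableEquiv.neg ℝ).measurableEmbedding).mpr hpos
    simpa [Function.comp_def] using h
  rw [← integrableOn_univ, ← Set.Iic_union_Ioi (a := (0 : ℝ))]
  exact hneg.union hpos

theorem integral_Ioc_const_mul_cos (w : ℝ) {a x : ℝ} (ha : 0 ≤ a) (hx : x ≠ 0) :
    ∫ K in Set.Ioc 0 a, w * Real.cos (K * x) = w * (Real.sin (a * x) / x) := by
  rw [← intervalIntegral.integral_of_le ha, intervalIntegral.integral_const_mul,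
    intervalIntegral.integral_comp_mul_right _ hx]
  simp [div_eq_inv_mul]

/-- For `h(U) = w` on `|U| ≤ U₀` and `h(U) = w·exp(−(|U|−U₀)³)` outside, and `x ≠ 0`,
the cosine transform `H(x) = ∫ h(U) cos(Ux) dU` converges absolutely and
`|H(x)| ≤ 2w(|sin(U₀x)|/|x| + ∫₀^∞ e^(−K³) dK) ≤ 2w(|sin(U₀x)|/|x| + 1)`. -/
theorem stmt_13 (w U₀ : ℝ) (hw : 0 < w) (hU₀ : 1 ≤ U₀)
    (h : ℝ → ℝ)
    (hh : ∀ U, h U = if |U| ≤ U₀ then w else w * Real.exp (-(|U| - U₀) ^ 3))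
    (x : ℝ) (hx : x ≠ 0) :
    Integrable (fun U => h U * Real.cos (U * x)) ∧
    |∫ U : ℝ, h U * Real.cos (U * x)|
        ≤ 2 * w * (|Real.sin (U₀ * x)| / |x| +
            ∫ K in Set.Ioi (0 : ℝ), Real.exp (-K ^ 3)) ∧
    2 * w * (|Real.sin (U₀ * x)| / |x| + ∫ K in Set.Ioi (0 : ℝ), Real.exp (-K ^ 3))
        ≤ 2 * w * (|Real.sin (U₀ * x)| / |x| + 1) := by
  have hU₀' : 0 ≤ U₀ := zero_le_one.trans hU₀
  set I := ∫ K in Set.Ioi (0 : ℝ), Real.exp (-K ^ 3) with hI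
  set f : ℝ → ℝ := fun K =>
    (if K ≤ U₀ then w else w * Real.exp (-(K - U₀) ^ 3)) * Real.cos (K * x) with hf
  have hfun : (fun U => h U * Real.cos (U * x)) = fun U => f |U| := by
    funext U
    have hcos : Real.cos (|U| * x) = Real.cos (U * x) := by
      rcases abs_choice U with hU | hU <;> simp [hU]
    simp only [hf, hh, hcos]
  have hinner : Set.EqOn f (fun K => w * Real.cos (K * x)) (Set.Ioc 0 U₀) := fun K hK => by
    simp only [hf, if_pos hK.2]
  have houter : Set.EqOn f (fun K => w * Real.exp (-(K - U₀) ^ 3) * Real.cos (K * x))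
      (Set.Ioi U₀) := fun K hK => by
    simp only [hf, if_neg (not_le.mpr (Set.mem_Ioi.mp hK))]
  have htail : IntegrableOn (fun K => w * Real.exp (-(K - U₀) ^ 3)) (Set.Ioi U₀) :=
    (integrableOn_Ioi_exp_neg_sub_cube U₀).const_mul w
  have hbound : ∀ K : ℝ, ‖w * Real.exp (-(K - U₀) ^ 3) * Real.cos (K * x)‖
      ≤ w * Real.exp (-(K - U₀) ^ 3) := fun K => by
    rw [norm_mul, Real.norm_of_nonneg (by positivity)]
    exact mul_le_of_le_one_right (by positivity) (Real.abs_cos_le_one _)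
  have hint_inner : IntegrableOn f (Set.Ioc 0 U₀) :=
    (Continuous.integrableOn_Ioc (by fun_prop)).congr_fun hinner.symm measurableSet_Ioc
  have hint_outer : IntegrableOn f (Set.Ioi U₀) :=
    IntegrableOn.congr_fun (htail.mono' (by fun_prop) (.of_forall hbound))
      houter.symm measurableSet_Ioi
  have hsplit : ∫ K in Set.Ioi 0, f K = w * (Real.sin (U₀ * x) / x) + ∫ K in Set.Ioi U₀, f K := by
    rw [← Set.Ioc_union_Ioi_eq_Ioi hU₀', setIntegral_union (Set.Ioc_disjoint_Ioi le_rfl)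
      measurableSet_Ioi hint_inner hint_outer, setIntegral_congr_fun measurableSet_Ioc hinner,
      integral_Ioc_const_mul_cos w hU₀' hx]
  have houter_le : |∫ K in Set.Ioi U₀, f K| ≤ w * I := by
    rw [setIntegral_congr_fun measurableSet_Ioi houter, hI, ← integral_Ioi_exp_neg_sub_cube U₀,
      ← integral_const_mul]
    exact norm_integral_le_of_norm_le htail (.of_forall hbound)
  rw [hfun]
  refine ⟨integrable_comp_abs_of_integrableOn_Ioi ?_, ?_, ?_⟩
  · rw [← Set.Ioc_union_Ioi_eq_Ioi hU₀']
    exact hint_inner.union hint_outer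
  · rw [integral_comp_abs, hsplit, abs_mul, abs_two, mul_assoc, mul_add w]
    gcongr
    refine (abs_add_le _ _).trans (add_le_add (le_of_eq ?_) houter_le)
    rw [abs_mul, abs_div, abs_of_pos hw]
  · gcongr
    exact integral_Ioi_exp_neg_cube_le_one
end

section
/- There exists a constant C > 0 such that for all integers n ≥ 2, ∫_{2√(n log n)}^∞ U⁴ e^{−U²/n} dU ≤ C · (log n)^{3/2} · n^{−3/2}. -/
open MeasureTheory

/-- A cubic times a centred Gaussian vanishes at infinity. -/
lemma tendsto_pow_three_mul_exp_neg_sq_div {b : ℝ} (hb : 0 < b) :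
    Filter.Tendsto (fun U : ℝ => U ^ 3 * Real.exp (-U ^ 2 / b)) Filter.atTop (nhds 0) := by
  have h := (tendsto_rpow_abs_mul_exp_neg_mul_sq_cocompact (inv_pos.2 hb) 3).mono_left
    atTop_le_cocompact
  refine h.congr' ?_
  filter_upwards [Filter.eventually_ge_atTop 0] with U hU
  rw [abs_of_nonneg hU, show (3 : ℝ) = (3 : ℕ) by norm_num, Real.rpow_natCast]
  congr 2
  ring

/-- Tail bound for the fourth moment of a Gaussian beyond a multiple of its standard deviation. -/
lemma integral_Ioi_pow_four_mul_exp_neg_sq_div_le {a b : ℝ} (hb : 0 < b) (ha : 0 ≤ a)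
    (hab : 2 * b ≤ a ^ 2) :
    ∫ U in Set.Ioi a, U ^ 4 * Real.exp (-U ^ 2 / b) ≤ 2 * b * (a ^ 3 * Real.exp (-a ^ 2 / b)) := by
  have hderiv : ∀ U : ℝ, HasDerivAt (fun U : ℝ => -(2 * b) * (U ^ 3 * Real.exp (-U ^ 2 / b)))
      ((4 * U ^ 4 - 6 * b * U ^ 2) * Real.exp (-U ^ 2 / b)) U := by
    intro U
    have h := ((hasDerivAt_pow 3 U).mul
      (((hasDerivAt_pow 2 U).neg.div_const b).exp)).const_mul (-(2 * b))
    refine h.congr_deriv ?_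
    simp only [Pi.neg_apply]
    push_cast
    field_simp
    ring
  have hlim : Filter.Tendsto (fun U : ℝ => -(2 * b) * (U ^ 3 * Real.exp (-U ^ 2 / b)))
      Filter.atTop (nhds 0) := by
    simpa using (tendsto_pow_three_mul_exp_neg_sq_div hb).const_mul (-(2 * b))
  have hle : ∀ U ∈ Set.Ioi a, U ^ 4 * Real.exp (-U ^ 2 / b)
      ≤ (4 * U ^ 4 - 6 * b * U ^ 2) * Real.exp (-U ^ 2 / b) := by
    intro U hU
    have hU' : a ^ 2 ≤ U ^ 2 := pow_le_pow_left₀ ha (le_of_lt hU) 2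
    gcongr
    nlinarith [mul_nonneg (sq_nonneg U) (sub_nonneg.2 (hab.trans hU'))]
  have hnonneg : ∀ U : ℝ, 0 ≤ U ^ 4 * Real.exp (-U ^ 2 / b) := fun U => by positivity
  have hint := integrableOn_Ioi_deriv_of_nonneg' (fun U _ => hderiv U)
    (fun U hU => (hnonneg U).trans (hle U hU)) hlim
  calc ∫ U in Set.Ioi a, U ^ 4 * Real.exp (-U ^ 2 / b)
      ≤ ∫ U in Set.Ioi a, (4 * U ^ 4 - 6 * b * U ^ 2) * Real.exp (-U ^ 2 / b) :=
        integral_mono_of_nonneg (Filter.Eventually.of_forall hnonneg) hint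
          ((ae_restrict_iff' measurableSet_Ioi).2 (Filter.Eventually.of_forall hle))
    _ = 2 * b * (a ^ 3 * Real.exp (-a ^ 2 / b)) := by
        rw [integral_Ioi_of_hasDerivAt_of_tendsto' (fun U _ => hderiv U) hint hlim]
        ring

/-- Gaussian-tail estimate: there is `C > 0` such that for all `n ≥ 2`,
`∫_{2√(n log n)}^∞ U⁴ e^(−U²/n) dU ≤ C (log n)^(3/2) n^(−3/2)`. -/
theorem stmt_16 :
    ∃ C : ℝ, 0 < C ∧
      ∀ n : ℕ, 2 ≤ n →
        (∫ U in Set.Ioi (2 * Real.sqrt (n * Real.log n)),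
            U ^ 4 * Real.exp (-U ^ 2 / n))
          ≤ C * Real.log n ^ ((3 : ℝ) / 2) * (n : ℝ) ^ (-(3 : ℝ) / 2) := by
  refine ⟨16, by norm_num, fun n hn => ?_⟩
  have hn2 : (2 : ℝ) ≤ n := by exact_mod_cast hn
  have hn0 : (0 : ℝ) < n := by linarith
  have hlog : 1 / 2 ≤ Real.log n := by
    linarith [Real.log_two_gt_d9, Real.log_le_log two_pos hn2]
  have hlog0 : 0 ≤ Real.log n := by linarith
  have hsq : (2 * √(n * Real.log n)) ^ 2 = 4 * (n * Real.log n) := by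
    rw [mul_pow, Real.sq_sqrt (by positivity)]
    norm_num
  refine (integral_Ioi_pow_four_mul_exp_neg_sq_div_le hn0 (by positivity)
    (by rw [hsq]; nlinarith)).trans_eq ?_
  have hexp : Real.exp (-(2 * √(n * Real.log n)) ^ 2 / n) = (n : ℝ) ^ (-4 : ℝ) := by
    rw [hsq, Real.rpow_def_of_pos hn0]
    congr 1
    field_simp
  have hcube : √(n * Real.log n) ^ 3
      = (n : ℝ) ^ ((3 : ℝ) / 2) * Real.log n ^ ((3 : ℝ) / 2) := by
    rw [← Real.mul_rpow hn0.le hlog0, Real.sqrt_eq_rpow, ← Real.rpow_mul_natCast (by positivity)]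
    norm_num
  have hpow : (n : ℝ) ^ (-(3 : ℝ) / 2) = n * (n : ℝ) ^ ((3 : ℝ) / 2) * (n : ℝ) ^ (-4 : ℝ) := by
    nth_rewrite 2 [← Real.rpow_one (n : ℝ)]
    rw [← Real.rpow_add hn0, ← Real.rpow_add hn0]
    norm_num
  rw [hexp, mul_pow, hcube, hpow]
  ring
end
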